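/- arXiv:math/0703526 — 3 statements merged into one kernel-verified Lean document; each statement's English description precedes it below -/
import Mathlib

section
/- Let m ∈ {1/2, 1, 2} (as a real number), let n ≥ 1 and s ≥ 2 be natural numbers, and set N = m(n+1). Then the equality (N)_{s-1} · (N−m)_s / ((m)_s · (s−1)!) = (N−m)(N+1)/m holds if and only if m = 1, n = 1 and s = 3. -/
/-- Rising factorial (Pochhammer symbol): `(x)_k = x(x+1)⋯(x+k−1)`, with `(x)_0 = 1`. -/
def risingFactorial (x : ℝ) : ℕ → ℝ
  | 0 => 1
  | k + 1 => risingFactorial x k * (x + k)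

theorem rf_pos {x : ℝ} (hx : 0 < x) (k : ℕ) : 0 < risingFactorial x k := by
  induction k with
  | zero => simp [risingFactorial]
  | succ k ih => simp only [risingFactorial]; positivity

/-- The left-hand side, with `s = k + 1`. -/
noncomputable def critG (m N : ℝ) (k : ℕ) : ℝ :=
  risingFactorial N k * risingFactorial (N - m) (k + 1) /
        (risingFactorial m (k + 1) * (Nat.factorial k : ℝ))

theorem critG_succ {m : ℝ} (hm : 0 < m) (N : ℝ) (k : ℕ) :
    critG m N (k + 1) =
      critG m N k * (((N + k) * (N - m + k + 1)) / ((m + k + 1) * (k + 1))) := by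
  have h1 := (rf_pos hm (k + 1)).ne'
  have h2 : (Nat.factorial k : ℝ) ≠ 0 := by positivity
  have h3 : m + k + 1 ≠ 0 := by positivity
  have h4 : (k : ℝ) + 1 ≠ 0 := by positivity
  have e (x : ℝ) : risingFactorial x (k + 1 + 1) = risingFactorial x (k + 1) * (x + k + 1) := by
    rw [risingFactorial]; push_cast; ring
  have e' : risingFactorial N (k + 1) = risingFactorial N k * (N + k) := rfl
  unfold critG
  rw [e, e, e', Nat.factorial_succ]
  push_cast
  field_simp

theorem critG_pos {m N : ℝ} (hm : 0 < m) (hN : m < N) (k : ℕ) : 0 < critG m N k := by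
  have h1 := rf_pos hm (k + 1)
  have h2 := rf_pos (hm.trans hN) k
  have h3 := rf_pos (sub_pos.2 hN) (k + 1)
  unfold critG
  positivity

theorem critG_mono {m N : ℝ} (hm : 0 < m) (hN : 2 * m ≤ N) (hN1 : 1 ≤ N) :
    Monotone (critG m N) := by
  refine monotone_nat_of_le_succ fun k => ?_
  rw [critG_succ hm]
  refine le_mul_of_one_le_right (critG_pos hm (by linarith) k).le ?_
  rw [one_le_div (by positivity), mul_comm (m + k + 1)]
  have : (0 : ℝ) ≤ k := k.cast_nonneg
  apply mul_le_mul <;> linarith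

theorem critG_zero {m : ℝ} (hm : 0 < m) (N : ℝ) : critG m N 0 = (N - m) / m := by
  simp [critG, risingFactorial]

theorem critG_one_two (k : ℕ) : critG 1 2 k = k + 1 := by
  induction k with
  | zero => rw [critG_zero one_pos]; norm_num
  | succ k ih =>
    rw [critG_succ one_pos, ih]
    have h4 : (k : ℝ) + 1 ≠ 0 := by positivity
    have h5 : (1 : ℝ) + k + 1 ≠ 0 := by positivity
    push_cast
    field_simp
    ring

theorem critG_half_one (k : ℕ) : critG (1/2) 1 k = 1 := by
  induction k with
  | zero => rw [critG_zero (by norm_num)]; norm_num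
  | succ k ih =>
    rw [critG_succ (by norm_num), ih]
    have h4 : (k : ℝ) + 1 ≠ 0 := by positivity
    have h5 : (1/2 : ℝ) + k + 1 ≠ 0 := by positivity
    rw [one_mul, div_eq_one_iff_eq (mul_ne_zero h5 h4)]
    ring

theorem critG_one {m : ℝ} (hm : 0 < m) (N : ℝ) :
    critG m N 1 = (N - m) / m * ((N * (N - m + 1)) / (m + 1)) := by
  have := critG_succ hm N 0
  simpa [critG_zero hm] using this

theorem critG_gt {m N : ℝ} (hm : 0 < m) (hN : 2 * m ≤ N) (hN1 : 1 ≤ N)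
    (h : (N + 1) * (m + 1) < N * (N - m + 1)) {k : ℕ} (hk : 1 ≤ k) :
    (N - m) * (N + 1) / m < critG m N k := by
  refine lt_of_lt_of_le ?_ (critG_mono hm hN hN1 hk)
  rw [critG_one hm, mul_div_right_comm]
  refine mul_lt_mul_of_pos_left ?_ (div_pos (by linarith) hm)
  rw [lt_div_iff₀ (by linarith)]
  exact h

/-- For `m ∈ {1/2, 1, 2}`, `n ≥ 1`, `s ≥ 2` and `N = m(n+1)`, the equality
`(N)_{s−1}·(N−m)_s / ((m)_s·(s−1)!) = (N−m)(N+1)/m` holds iff `m = 1`, `n = 1`, `s = 3`. -/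
theorem critical_inequality_characterization
    (m : ℝ) (hm : m ∈ ({1/2, 1, 2} : Set ℝ))
    (n s : ℕ) (hn : 1 ≤ n) (hs : 2 ≤ s)
    (N : ℝ) (hN : N = m * (n + 1)) :
    risingFactorial N (s - 1) * risingFactorial (N - m) s /
        (risingFactorial m s * (Nat.factorial (s - 1) : ℝ))
      = (N - m) * (N + 1) / m
    ↔ (m = 1 ∧ n = 1 ∧ s = 3) := by
  obtain ⟨k, rfl⟩ : ∃ k, s = k + 1 := ⟨s - 1, by omega⟩
  have hk : 1 ≤ k := by omega
  change critG m N k = _ ↔ _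
  have hn' : (1 : ℝ) ≤ n := by exact_mod_cast hn
  rcases hm with rfl | rfl | hm
  · have hne : ¬ ((1/2 : ℝ) = 1 ∧ n = 1 ∧ k + 1 = 3) := by norm_num
    refine iff_of_false ?_ hne
    rcases (by omega : n = 1 ∨ n = 2 ∨ 3 ≤ n) with rfl | rfl | h3
    · have : N = 1 := by rw [hN]; norm_num
      rw [this, critG_half_one]; norm_num
    · have : N = 3/2 := by rw [hN]; norm_num
      subst this
      have h1 : critG (1/2) (3/2) 1 = 4 := by rw [critG_one (by norm_num)]; norm_num
      have h2 : critG (1/2) (3/2) 2 = 6 := by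
        rw [critG_succ (by norm_num), h1]; norm_num
      rcases (by omega : k = 1 ∨ 2 ≤ k) with rfl | h
      · rw [h1]; norm_num
      · have := critG_mono (m := 1/2) (N := 3/2) (by norm_num) (by norm_num) (by norm_num) h
        rw [h2] at this
        intro h; rw [h] at this; norm_num at this
    · have h3' : (3 : ℝ) ≤ n := by exact_mod_cast h3
      refine (critG_gt (by norm_num) (by linarith) (by linarith) ?_ hk).ne'
      rw [hN]; nlinarith
  · rcases (by omega : n = 1 ∨ 2 ≤ n) with rfl | h3
    · have : N = 2 := by rw [hN]; norm_num
      rw [this, critG_one_two]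
      constructor
      · intro h
        have : (k : ℝ) = 2 := by linarith
        have : k = 2 := by exact_mod_cast this
        simp [this]
      · rintro ⟨-, -, h⟩
        have : k = 2 := by omega
        subst this; norm_num
    · have h3' : (2 : ℝ) ≤ n := by exact_mod_cast h3
      refine iff_of_false (critG_gt (by norm_num) (by linarith) (by linarith) ?_ hk).ne' (by omega)
      rw [hN]; nlinarith
  · have hm : m = 2 := hm
    subst hm
    have hne : ¬ ((2 : ℝ) = 1 ∧ n = 1 ∧ k + 1 = 3) := by norm_num
    refine iff_of_false ?_ hne
    rcases (by omega : n = 1 ∨ 2 ≤ n) with rfl | h3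
    · have : N = 4 := by rw [hN]; norm_num
      subst this
      have h1 : critG 2 4 1 = 4 := by rw [critG_one (by norm_num)]; norm_num
      have h2 : critG 2 4 2 = 10 := by
        rw [critG_succ (by norm_num), h1]; norm_num
      rcases (by omega : k = 1 ∨ 2 ≤ k) with rfl | h
      · rw [h1]; norm_num
      · have := critG_mono (m := 2) (N := 4) (by norm_num) (by norm_num) (by norm_num) h
        rw [h2] at this
        intro h; rw [h] at this; norm_num at this
    · have h3' : (2 : ℝ) ≤ n := by exact_mod_cast h3
      refine (critG_gt (by norm_num) (by linarith) (by linarith) ?_ hk).ne'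
      rw [hN]; nlinarith
end

section
/- For every real number m > 0, every real number N, and every natural number s ≥ 1: 1 + Σ_{i=1}^{s−1} (N)_{i−1} · (N−m)_i · (N+2i−1) / ((m)_i · i!) = (N)_{s−1} · (N−m+1)_{s−1} / ((m)_{s−1} · (s−1)!). -/
theorem risingFactorial_succ_left (x : ℝ) (k : ℕ) :
    risingFactorial x (k + 1) = x * risingFactorial (x + 1) k := by
  induction k with
  | zero => simp [risingFactorial]
  | succ k ih =>
    rw [risingFactorial, ih, risingFactorial]
    push_cast
    ring

theorem risingFactorial_pos (x : ℝ) (hx : 0 < x) (k : ℕ) : 0 < risingFactorial x k := by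
  induction k with
  | zero => simp [risingFactorial]
  | succ k ih =>
    rw [risingFactorial]
    positivity

/-- `1 + Σ_{i=1}^{s−1} (N)_{i−1}·(N−m)_i·(N+2i−1)/((m)_i·i!)
  = (N)_{s−1}·(N−m+1)_{s−1}/((m)_{s−1}·(s−1)!)`. -/
theorem sum_of_ranks_identity
    (m : ℝ) (hm : 0 < m) (N : ℝ) (s : ℕ) (hs : 1 ≤ s) :
    1 + ∑ i ∈ Finset.Icc 1 (s - 1),
        risingFactorial N (i - 1) * risingFactorial (N - m) i * (N + 2 * i - 1) /
          (risingFactorial m i * (Nat.factorial i : ℝ))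
      = risingFactorial N (s - 1) * risingFactorial (N - m + 1) (s - 1) /
        (risingFactorial m (s - 1) * (Nat.factorial (s - 1) : ℝ)) := by
  obtain ⟨n, rfl⟩ : ∃ n, s = n + 1 := ⟨s - 1, by omega⟩
  clear hs
  simp only [Nat.add_sub_cancel]
  induction n with
  | zero => simp [risingFactorial]
  | succ n ih =>
    rw [Finset.sum_Icc_succ_top (by omega), ← add_assoc, ih, Nat.add_sub_cancel,
      risingFactorial_succ_left (N - m), Nat.factorial_succ]
    simp only [risingFactorial]
    have h1 := (risingFactorial_pos m hm n).ne'
    have h2 : (Nat.factorial n : ℝ) ≠ 0 := by positivity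
    have h3 : m + (n : ℝ) ≠ 0 := by positivity
    have h4 : (n : ℝ) + 1 ≠ 0 := by positivity
    push_cast
    field_simp
    ring
end

section
/- For every natural number t ≥ 1 and every real polynomial F with deg F ≤ t: (1/(t+1))·Σ_{j=0}^{t} F(cos²(jπ/(t+1))) = (1/π)·∫₀¹ F(ξ)·ξ^{−1/2}(1−ξ)^{−1/2} dξ. -/
open Polynomial Polynomial.Chebyshev in
lemma aux_integral (F : Polynomial ℝ) :
    ∫ ξ in (0 : ℝ)..1, F.eval ξ * ξ ^ (-(1/2) : ℝ) * (1 - ξ) ^ (-(1/2) : ℝ)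
      = ∫ x, (F.comp (C (1/2) * X + C (1/2))).eval x ∂measureT := by
  rw [integral_measureT]
  have h := intervalIntegral.integral_comp_mul_add (a := -1) (b := 1) (c := (1/2 : ℝ))
    (fun ξ : ℝ => F.eval ξ * ξ ^ (-(1/2) : ℝ) * (1 - ξ) ^ (-(1/2) : ℝ)) (by norm_num) (1/2)
  norm_num only [smul_eq_mul] at h
  have h2 : ∫ ξ in (0 : ℝ)..1, F.eval ξ * ξ ^ (-(1/2) : ℝ) * (1 - ξ) ^ (-(1/2) : ℝ)
      = (1/2) * ∫ x in (-1 : ℝ)..1, F.eval (1/2 * x + 1/2) * (1/2 * x + 1/2) ^ (-(1/2) : ℝ)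
        * (1 - (1/2 * x + 1/2)) ^ (-(1/2) : ℝ) := by
    norm_num only
    rw [h]; ring
  rw [h2, ← intervalIntegral.integral_const_mul]
  apply intervalIntegral.integral_congr
  intro x hx
  rw [Set.uIcc_of_le (by norm_num)] at hx
  obtain ⟨h0, h1⟩ := hx
  have key : (1/2 * x + 1/2) ^ (-(1/2) : ℝ) * (1 - (1/2 * x + 1/2)) ^ (-(1/2) : ℝ)
      = 2 * √(1 - x ^ 2)⁻¹ := by
    rw [← Real.mul_rpow (by linarith) (by linarith), Real.rpow_neg (by nlinarith),
      ← Real.sqrt_eq_rpow,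
      show (1/2 * x + 1/2) * (1 - (1/2 * x + 1/2)) = (1 - x^2) / 2^2 by ring,
      Real.sqrt_div' _ (by norm_num), Real.sqrt_sq (by norm_num), Real.sqrt_inv, inv_div]
    rfl
  simp only [eval_comp, eval_add, eval_mul, eval_C, eval_X]
  rw [mul_assoc (F.eval _), key]
  ring

lemma aux_sum_cos (n k : ℕ) (hk : k ≠ 0) (hkn : k < n) :
    ∑ j ∈ Finset.range n, Real.cos (k * (2 * (j * Real.pi / n))) = 0 := by
  have hn : n ≠ 0 := by omega
  have hp := Complex.isPrimitiveRoot_exp n hn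
  set ζ := Complex.exp (2 * Real.pi * Complex.I / n) with hζ
  have hz1 : ζ ^ k ≠ 1 := hp.pow_ne_one_of_pos_of_lt hk hkn
  have hzn : (ζ ^ k) ^ n = 1 := by rw [← pow_mul, mul_comm, pow_mul, hp.pow_eq_one, one_pow]
  have hs : ∑ j ∈ Finset.range n, (ζ ^ k) ^ j = 0 := by
    have := geom_sum_mul (ζ ^ k) n
    rw [hzn, sub_self] at this
    exact (mul_eq_zero.mp this).resolve_right (sub_ne_zero.mpr hz1)
  have := congrArg Complex.re hs
  rw [Complex.re_sum, Complex.zero_re] at this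
  rw [← this]
  refine Finset.sum_congr rfl fun j _ => ?_
  rw [hζ, ← Complex.exp_nat_mul, ← Complex.exp_nat_mul, ← Complex.exp_ofReal_mul_I_re]
  congr 2
  push_cast
  ring

open Polynomial Polynomial.Chebyshev in
lemma aux_quad (n : ℕ) (hn : n ≠ 0) (P : Polynomial ℝ) (hP : P.degree < n) :
    (1 / (n : ℝ)) * ∑ j ∈ Finset.range n, P.eval (Real.cos (2 * (j * Real.pi / n)))
      = (1 / Real.pi) * ∫ x, P.eval x ∂measureT := by
  have hmem : P ∈ degreeLT ℝ n := by rwa [mem_degreeLT]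
  rw [← Sequence.span_degreeLT (chebyshevTsequence ℝ) (by simp),
    show Set.Iio n = Finset.range n by simp,
    Submodule.mem_span_image_finset_iff_exists_fun'] at hmem
  obtain ⟨c, rfl⟩ := hmem
  simp_rw [eval_finsetSum, eval_smul]
  rw [MeasureTheory.integral_finsetSum, Finset.sum_comm, Finset.mul_sum, Finset.mul_sum]
  · refine Finset.sum_congr rfl fun i hi => ?_
    simp_rw [smul_eq_mul, MeasureTheory.integral_const_mul, ← Finset.mul_sum, chebyshevTsequence]
    by_cases h : i = 0
    · subst h
      rw [Nat.cast_zero, integral_eval_T_real_measureT_zero]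
      have : (n : ℝ) ≠ 0 := by exact_mod_cast hn
      have := Real.pi_ne_zero
      simp
      field_simp
    · rw [integral_eval_T_real_measureT_of_ne_zero (by exact_mod_cast h)]
      simp_rw [T_real_cos]
      have := aux_sum_cos n i h (Finset.mem_range.mp hi)
      simp only [Int.cast_natCast]
      rw [this]; simp
  · intro i _
    simp_rw [← eval_smul]
    exact integrable_measureT (Polynomial.continuous _).continuousOn

/-- The projective images of the vertices of a regular `(2t+2)`-gon form a tight
`t`-design in `ℝP¹`: for every real polynomial `F` of degree at most `t`,
`(1/(t+1))·Σ_{j=0}^{t} F(cos²(jπ/(t+1)))` equals the integral of `F` against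
the arcsine density `(1/π)·ξ^{−1/2}(1−ξ)^{−1/2}` on `(0,1)`. -/
theorem regular_polygon_tight_design
    (t : ℕ) (ht : 1 ≤ t)
    (F : Polynomial ℝ) (hF : F.natDegree ≤ t) :
    (1 / ((t : ℝ) + 1)) *
        ∑ j ∈ Finset.range (t + 1), F.eval ((Real.cos (j * Real.pi / (t + 1))) ^ 2)
      = (1 / Real.pi) *
        ∫ ξ in (0 : ℝ)..1, F.eval ξ * ξ ^ (-(1/2) : ℝ) * (1 - ξ) ^ (-(1/2) : ℝ) := by
  rw [aux_integral, ← aux_quad (t + 1) (by omega)]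
  · push_cast
    congr 1
    refine Finset.sum_congr rfl fun j _ => ?_
    rw [Polynomial.eval_comp, Real.cos_sq]
    congr 1
    simp
    ring
  · refine lt_of_le_of_lt Polynomial.degree_le_natDegree ?_
    have h1 : (Polynomial.C (1/2 : ℝ) * Polynomial.X + Polynomial.C (1/2)).natDegree ≤ 1 :=
      Polynomial.natDegree_linear_le
    have h2 := Nat.mul_le_mul hF h1
    rw [Polynomial.natDegree_comp]
    exact_mod_cast (by omega)
end
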